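/- arXiv:2012.04534 — 2 statements merged into one kernel-verified Lean document; each statement's English description precedes it below -/
import Mathlib

section
/- Let G be an n×p complex matrix, A an m×n complex matrix, k ∈ ℕ with 1 ≤ k ≤ p, and N ≥ 1. Let A_blk and G_blk denote the block-diagonal matrices with N copies of A and of G respectively. Then the restricted isometry constant of A_blk adapted to the dictionary G_blk equals the restricted isometry constant of A adapted to G; that is, δ_k^{G_blk}(A_blk) = δ_k^{G}(A). -/
/-- `Uk G k` is the union, over all index sets `S` of cardinality `k`, of the
linear spans of the corresponding `k` columns of `G`. -/
def Uk {ι κ : Type*} (G : Matrix ι κ ℂ) (k : ℕ) : Set (ι → ℂ) :=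
  {y | ∃ S : Finset κ, S.card = k ∧
    y ∈ Submodule.span ℂ ((fun j => fun i => G i j) '' (S : Set κ))}

/-- The restricted isometry constant of `Ψ` adapted to the dictionary `G`:
the infimum of all `δ ≥ 0` such that
`(1−δ)·‖y‖² ≤ ‖Ψ·y‖² ≤ (1+δ)·‖y‖²` for all `y ∈ U_k(G)`. -/
noncomputable def ric {ι κ μ : Type*} [Fintype ι] [Fintype μ]
    (Ψ : Matrix μ ι ℂ) (G : Matrix ι κ ℂ) (k : ℕ) : ℝ :=
  sInf {δ : ℝ | 0 ≤ δ ∧ ∀ y ∈ Uk G k,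
    (1 - δ) * ∑ i, ‖y i‖ ^ 2 ≤ ∑ j, ‖Ψ.mulVec y j‖ ^ 2 ∧
    ∑ j, ‖Ψ.mulVec y j‖ ^ 2 ≤ (1 + δ) * ∑ i, ‖y i‖ ^ 2}

theorem block_mem_Uk {p n N k : ℕ} (hk2 : k ≤ p) (G : Matrix (Fin n) (Fin p) ℂ)
    (y : Fin n × Fin N → ℂ) (hy : y ∈ Uk (Matrix.blockDiagonal (fun _ : Fin N => G)) k)
    (l : Fin N) : (fun i => y (i, l)) ∈ Uk G k := by
  classical
  obtain ⟨S, hS, hy⟩ := hy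
  have hc : (Finset.univ.filter (fun j : Fin p => (j, l) ∈ S)).card ≤ k := by
    rw [← hS]
    refine Finset.card_le_card_of_injOn (fun j => (j, l)) ?_ ?_
    · intro j hj
      simpa using hj
    · intro a _ b _ h
      simpa using h
  obtain ⟨T, hT, hTc⟩ := Finset.exists_superset_card_eq hc (by simpa using hk2)
  refine ⟨T, hTc, ?_⟩
  let f : (Fin n × Fin N → ℂ) →ₗ[ℂ] (Fin n → ℂ) := LinearMap.funLeft ℂ ℂ (fun i => (i, l))
  have key : Submodule.span ℂ ((fun j => fun i =>
      Matrix.blockDiagonal (fun _ : Fin N => G) i j) '' (S : Set (Fin p × Fin N))) ≤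
      (Submodule.span ℂ ((fun j => fun i => G i j) '' (T : Set (Fin p)))).comap f := by
    rw [Submodule.span_le]
    rintro _ ⟨⟨j, l'⟩, hj, rfl⟩
    change (fun i => Matrix.blockDiagonal (fun _ : Fin N => G) (i, l) (j, l')) ∈
      Submodule.span ℂ ((fun j => fun i => G i j) '' (T : Set (Fin p)))
    by_cases h : l = l'
    · subst h
      simp only [Matrix.blockDiagonal_apply, if_true]
      exact Submodule.subset_span ⟨j, hT (by simpa using hj), rfl⟩
    · simp only [Matrix.blockDiagonal_apply, if_neg h]
      exact Submodule.zero_mem _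
  exact key hy

theorem embed_mem_Uk {p n N k : ℕ} (G : Matrix (Fin n) (Fin p) ℂ)
    (y : Fin n → ℂ) (hy : y ∈ Uk G k) (l : Fin N) :
    (fun q : Fin n × Fin N => if q.2 = l then y q.1 else 0) ∈
      Uk (Matrix.blockDiagonal (fun _ : Fin N => G)) k := by
  classical
  obtain ⟨S, hS, hy⟩ := hy
  refine ⟨S.map ⟨fun j => (j, l), fun a b h => by simpa using h⟩, by simpa using hS, ?_⟩
  let f : (Fin n → ℂ) →ₗ[ℂ] (Fin n × Fin N → ℂ) :=
    { toFun := fun y q => if q.2 = l then y q.1 else 0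
      map_add' := by
        intro a b; ext q; by_cases h : q.2 = l <;> simp [h]
      map_smul' := by
        intro a b; ext q; by_cases h : q.2 = l <;> simp [h] }
  have key : Submodule.span ℂ ((fun j => fun i => G i j) '' (S : Set (Fin p))) ≤
      (Submodule.span ℂ ((fun j => fun i =>
      Matrix.blockDiagonal (fun _ : Fin N => G) i j) ''
        ((S.map ⟨fun j => (j, l), fun a b h => by simpa using h⟩ : Finset (Fin p × Fin N)) :
          Set (Fin p × Fin N)))).comap f := by
    rw [Submodule.span_le]
    rintro _ ⟨j, hj, rfl⟩
    refine Submodule.subset_span ⟨(j, l), Finset.mem_coe.2 (Finset.mem_map.2 ⟨j, hj, rfl⟩), ?_⟩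
    ext q
    simp [f, Matrix.blockDiagonal_apply]
  exact key hy

theorem blk_mulVec {m n N : ℕ} (A : Matrix (Fin m) (Fin n) ℂ) (y : Fin n × Fin N → ℂ)
    (a : Fin m) (l : Fin N) :
    (Matrix.blockDiagonal (fun _ : Fin N => A)).mulVec y (a, l) =
      A.mulVec (fun i => y (i, l)) a := by
  simp [Matrix.mulVec, dotProduct, Fintype.sum_prod_type, Matrix.blockDiagonal_apply]

/-- The restricted isometry constant of the block-diagonal
matrix with `N` copies of `A`, adapted to the block-diagonal dictionary with
`N` copies of `G`, equals the restricted isometry constant of `A` adapted to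
`G`. -/
theorem ric_blockDiagonal_eq
    (m n p N k : ℕ) (hk1 : 1 ≤ k) (hk2 : k ≤ p) (hN : 1 ≤ N)
    (A : Matrix (Fin m) (Fin n) ℂ) (G : Matrix (Fin n) (Fin p) ℂ) :
    ric (Matrix.blockDiagonal (fun _ : Fin N => A))
        (Matrix.blockDiagonal (fun _ : Fin N => G)) k
      = ric A G k := by
  unfold ric
  congr 1
  ext δ
  refine and_congr_right fun _ => ⟨fun h y hy => ?_, fun h y hy => ?_⟩
  · have := h _ (embed_mem_Uk G y hy (⟨0, hN⟩ : Fin N))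
    simp only [Fintype.sum_prod_type_right, blk_mulVec] at this
    have e1 : ∑ l : Fin N, ∑ i, ‖(if l = (⟨0, hN⟩ : Fin N) then y i else 0)‖ ^ 2
        = ∑ i, ‖y i‖ ^ 2 := by
      rw [Finset.sum_eq_single (⟨0, hN⟩ : Fin N)]
      · simp
      · intro b _ hb
        simp [hb]
      · simp
    have e2 : ∑ l : Fin N, ∑ j, ‖A.mulVec
        (fun i => if l = (⟨0, hN⟩ : Fin N) then y i else 0) j‖ ^ 2
        = ∑ j, ‖A.mulVec y j‖ ^ 2 := by
      rw [Finset.sum_eq_single (⟨0, hN⟩ : Fin N)]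
      · simp
      · intro b _ hb
        simp [hb, Matrix.mulVec, dotProduct]
      · simp
    rwa [e1, e2] at this
  · simp only [Fintype.sum_prod_type_right, blk_mulVec, Finset.mul_sum (s := (Finset.univ : Finset (Fin N)))]
    exact ⟨Finset.sum_le_sum fun l _ => (h _ (block_mem_Uk hk2 G y hy l)).1,
      Finset.sum_le_sum fun l _ => (h _ (block_mem_Uk hk2 G y hy l)).2⟩
end

section
/- Let D be an m×p complex matrix and define the real p×p matrix J with entries J_{ij} = Re((Dᴴ·D)_{ij}), where Dᴴ is the conjugate transpose. Then J is symmetric and positive semidefinite, its rank is at most 2m, and in particular if p > 2m then J is singular (not invertible). -/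
open Matrix

/-- For an `m × p` complex matrix `D`, the real matrix
`J = Re(Dᴴ·D)` is symmetric and positive semidefinite, has rank at most `2m`,
and is singular whenever `p > 2m`. -/
theorem re_gram_symm_psd_rank_le
    (m p : ℕ) (D : Matrix (Fin m) (Fin p) ℂ) :
    ((Dᴴ * D).map Complex.re).IsSymm ∧
    ((Dᴴ * D).map Complex.re).PosSemidef ∧
    ((Dᴴ * D).map Complex.re).rank ≤ 2 * m ∧
    (2 * m < p → ¬ IsUnit ((Dᴴ * D).map Complex.re)) := by
  have key : (Dᴴ * D).map Complex.re =
      (Matrix.fromRows (D.map Complex.re) (D.map Complex.im))ᴴ *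
        Matrix.fromRows (D.map Complex.re) (D.map Complex.im) := by
    ext i j
    simp [Matrix.mul_apply, Fintype.sum_sum_type, Finset.sum_add_distrib]
  have hps : ((Dᴴ * D).map Complex.re).PosSemidef := by
    rw [key]
    exact Matrix.posSemidef_conjTranspose_mul_self _
  have hr : ((Dᴴ * D).map Complex.re).rank ≤ 2 * m := by
    rw [key]
    refine (Matrix.rank_mul_le_right _ _).trans ((Matrix.rank_le_card_height _).trans ?_)
    simp [two_mul]
  refine ⟨?_, hps, hr, ?_⟩
  · have h := hps.isHermitian
    rwa [Matrix.IsHermitian, Matrix.conjTranspose_eq_transpose_of_trivial] at h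
  · intro hlt hu
    have h := Matrix.rank_of_isUnit _ hu
    rw [Fintype.card_fin] at h
    omega
end
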